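/- arXiv:2505.17960 — 2 statements merged into one kernel-verified Lean document; each statement's English description precedes it below -/
import Mathlib

section
/- Every Ramsey ultrafilter is a Q-point: let U be a non-principal ultrafilter on ℕ such that the Maiden has no winning strategy in the ultrafilter game for U. Then for every interval partition {[k_i, k_{i+1}) : i ∈ ℕ} of ℕ there exists x ∈ U with |x ∩ [k_i, k_{i+1})| ≤ 1 for all i. -/
/-- An ultrafilter on ℕ is non-principal iff it contains no finite sets. -/
def NonPrincipal (U : Ultrafilter ℕ) : Prop :=
  ∀ s : Set ℕ, s.Finite → s ∉ U

/-- In the ultrafilter game, a strategy for the Maiden is a function assigning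
to each finite sequence of Death's previous moves the Maiden's next move (a set).
`PartialPlay σ l` says that the finite sequence `l` of Death's moves is a legal
partial play against the strategy `σ`: each move is an element of the set the
Maiden just played and is larger than all previous moves. -/
inductive PartialPlay (σ : List ℕ → Set ℕ) : List ℕ → Prop
  | nil : PartialPlay σ []
  | snoc (l : List ℕ) (m : ℕ) : PartialPlay σ l → m ∈ σ l → (∀ x ∈ l, x < m) →
      PartialPlay σ (l ++ [m])

/-- A strategy for the Maiden in the ultrafilter game for `U` is legal iff its
opening move is in `U`, and after any legal partial play `l` followed by a legal
move `m` of Death, her next move is an infinite subset of her previous move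
lying in `U`. -/
def MaidenLegal (U : Ultrafilter ℕ) (σ : List ℕ → Set ℕ) : Prop :=
  σ [] ∈ U ∧
    ∀ l m, PartialPlay σ l → m ∈ σ l → (∀ x ∈ l, x < m) →
      σ (l ++ [m]) ∈ U ∧ (σ (l ++ [m])).Infinite ∧ σ (l ++ [m]) ⊆ σ l

/-- `DeathPlay σ n` says that `n` enumerates an infinite legal play of Death
against the Maiden's strategy `σ`: the moves are strictly increasing and each
move `n k` belongs to the set the Maiden plays after Death's first `k` moves. -/
def DeathPlay (σ : List ℕ → Set ℕ) (n : ℕ → ℕ) : Prop :=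
  StrictMono n ∧ ∀ k : ℕ, n k ∈ σ ((List.range k).map n)

/-- A legal strategy for the Maiden is winning iff for every infinite legal play
of Death against it, the set of Death's moves is not in `U` (Death loses). -/
def MaidenWinning (U : Ultrafilter ℕ) (σ : List ℕ → Set ℕ) : Prop :=
  MaidenLegal U σ ∧ ∀ n : ℕ → ℕ, DeathPlay σ n → Set.range n ∉ U

/-- `U` is a Ramsey ultrafilter iff the Maiden has no winning strategy in the
ultrafilter game for `U`. -/
def IsRamsey (U : Ultrafilter ℕ) : Prop :=
  ¬ ∃ σ : List ℕ → Set ℕ, MaidenWinning U σ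

theorem ramsey_is_qpoint
    (U : Ultrafilter ℕ) (hU : NonPrincipal U) (hR : IsRamsey U)
    (k : ℕ → ℕ) (hk : StrictMono k) (hk0 : k 0 = 0) :
    ∃ x ∈ U, ∀ i : ℕ, (x ∩ Set.Ico (k i) (k (i + 1))).ncard ≤ 1 := by
  by_contra hcon
  push Not at hcon
  -- The Maiden always jumps to a later block of the partition.
  let σ : List ℕ → Set ℕ := fun l => {n | ∀ m ∈ l, ∃ j, m < k j ∧ k j ≤ n}
  have hmem : ∀ l, σ l ∈ U := by
    intro l
    by_contra h
    have h1 : (σ l)ᶜ ∈ U := Ultrafilter.compl_mem_iff_notMem.mpr h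
    refine hU _ ?_ h1
    refine (Set.finite_Iio (k (l.sum + 1))).subset ?_
    intro n hn
    by_contra hlt
    apply hn
    intro m hm
    have hle : m ≤ l.sum := List.le_sum_of_mem hm
    have h2 : l.sum + 1 ≤ k (l.sum + 1) := hk.id_le _
    have h3 : ¬ n < k (l.sum + 1) := hlt
    exact ⟨l.sum + 1, by omega, by omega⟩
  refine hR ⟨σ, ⟨hmem [], ?_⟩, ?_⟩
  · intro l m _ _ _
    refine ⟨hmem _, fun hf => hU _ hf (hmem _), ?_⟩
    intro n hn x hx
    exact hn x (List.mem_append_left _ hx)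
  · intro n hn hr
    obtain ⟨i, hi⟩ := hcon _ hr
    have key : ∀ a b, a < b → n a ∈ Set.Ico (k i) (k (i + 1)) →
        n b ∈ Set.Ico (k i) (k (i + 1)) → False := by
      intro a b hab ha hb
      obtain ⟨j, hj1, hj2⟩ := hn.2 b (n a)
        (List.mem_map.mpr ⟨a, List.mem_range.mpr hab, rfl⟩)
      have h1 : i < j := hk.lt_iff_lt.mp (lt_of_le_of_lt ha.1 hj1)
      have h2 : j < i + 1 := hk.lt_iff_lt.mp (lt_of_le_of_lt hj2 hb.2)
      omega
    have hle : (Set.range n ∩ Set.Ico (k i) (k (i + 1))).ncard ≤ 1 := by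
      rw [Set.ncard_le_one ((Set.finite_Ico _ _).inter_of_right _)]
      rintro _ ⟨⟨a, rfl⟩, ha⟩ _ ⟨⟨b, rfl⟩, hb⟩
      rcases lt_trichotomy a b with h | h | h
      · exact (key a b h ha hb).elim
      · rw [h]
      · exact (key b a h hb ha).elim
    omega
end

section
/- Let U be a non-principal ultrafilter on ℕ such that the Maiden has no winning strategy in the ultrafilter game for U (i.e., U is a Ramsey ultrafilter), let x₁ ∈ U be infinite, and let C be any function assigning to each finite subset t of ℕ a finite subset C_t of ℕ. Then there exists an infinite x₂ ∈ U with x₂ ⊆ x₁ such that for every finite subset t of x₂, every m ∈ x₂ with m ≥ max t, and all n, n′ ∈ x₂ with n > m and n′ > m, one has C_{t ∪ {n}} ∩ {0, 1, …, m} = C_{t ∪ {n′}} ∩ {0, 1, …, m}. -/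
/-- The maximum of a finite set of naturals, with `max ∅ = 0`. -/
def finMax (t : Finset ℕ) : ℕ := t.sup id

theorem ramsey_stabilizes_finite_set_function
    (U : Ultrafilter ℕ) (hU : NonPrincipal U) (hR : IsRamsey U)
    (x₁ : Set ℕ) (hx₁ : x₁ ∈ U) (hx₁inf : x₁.Infinite)
    (C : Finset ℕ → Finset ℕ) :
    ∃ x₂ : Set ℕ, x₂ ∈ U ∧ x₂ ⊆ x₁ ∧ x₂.Infinite ∧
      ∀ t : Finset ℕ, ↑t ⊆ x₂ →
        ∀ m ∈ x₂, finMax t ≤ m →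
          ∀ n ∈ x₂, ∀ n' ∈ x₂, m < n → m < n' →
            C (insert n t) ∩ Finset.Iic m = C (insert n' t) ∩ Finset.Iic m := by
  classical
  let A : ℕ → Set ℕ := fun m => {n | ∀ t ∈ (Finset.Iic m).powerset, ∀ j ∈ Finset.Iic m,
    (j ∈ C (insert n t) ↔ {k | j ∈ C (insert k t)} ∈ U)}
  have hA : ∀ m, A m ∈ U := by
    intro m
    have : ∀ᶠ n in (U : Filter ℕ), ∀ t ∈ (Finset.Iic m).powerset, ∀ j ∈ Finset.Iic m,
        (j ∈ C (insert n t) ↔ {k | j ∈ C (insert k t)} ∈ U) := by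
      rw [Filter.eventually_all_finset]
      intro t _
      rw [Filter.eventually_all_finset]
      intro j _
      by_cases h : {k | j ∈ C (insert k t)} ∈ U
      · filter_upwards [h] with n hn
        exact ⟨fun _ => h, fun _ => hn⟩
      · have h2 := Ultrafilter.compl_mem_iff_notMem.mpr h
        filter_upwards [h2] with n hn
        exact ⟨fun h3 => absurd h3 hn, fun h3 => absurd h3 h⟩
    exact this
  let σ : List ℕ → Set ℕ := fun l => {n | n ∈ x₁ ∧ ∀ m ∈ l, n ∈ A m}
  have hσ : ∀ l, σ l ∈ U := by
    intro l
    have h : ∀ᶠ n in (U : Filter ℕ), ∀ m ∈ l.toFinset, n ∈ A m := by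
      rw [Filter.eventually_all_finset]
      intro m _
      exact hA m
    filter_upwards [hx₁, h] with n h1 h2
    exact ⟨h1, fun m hm => h2 m (List.mem_toFinset.mpr hm)⟩
  have hinf : ∀ s : Set ℕ, s ∈ U → s.Infinite := fun s hs hf => hU s hf hs
  have hlegal : MaidenLegal U σ := by
    refine ⟨hσ _, fun l m _ _ _ => ⟨hσ _, hinf _ (hσ _), fun n hn => ⟨hn.1, fun k hk => hn.2 k ?_⟩⟩⟩
    exact List.mem_append_left _ hk
  have hex : ∃ n : ℕ → ℕ, DeathPlay σ n ∧ Set.range n ∈ U := by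
    by_contra hc
    push Not at hc
    exact hR ⟨σ, hlegal, hc⟩
  obtain ⟨f, ⟨hmono, hf⟩, hfU⟩ := hex
  refine ⟨Set.range f, hfU, ?_, hinf _ hfU, ?_⟩
  · rintro _ ⟨k, rfl⟩
    exact (hf k).1
  · have key : ∀ i k, f i < f k → f k ∈ A (f i) := by
      intro i k h
      exact (hf k).2 _ (List.mem_map.mpr ⟨i, List.mem_range.mpr (hmono.lt_iff_lt.mp h), rfl⟩)
    rintro t - _ ⟨i, rfl⟩ hmax _ ⟨a, rfl⟩ _ ⟨b, rfl⟩ ha hb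
    have ht : t ∈ (Finset.Iic (f i)).powerset := by
      rw [Finset.mem_powerset]
      intro x hx
      exact Finset.mem_Iic.mpr (le_trans (Finset.le_sup (f := id) hx) hmax)
    ext j
    simp only [Finset.mem_inter]
    refine and_congr_left fun hj => ?_
    exact (key i a ha t ht j hj).trans (key i b hb t ht j hj).symm
end
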